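/- Let d ≥ 1, p ∈ ℕ, let Ω ⊆ ℝ^d × ℝ be open, (z, s) ∈ Ω, and let u : ℝ^d × ℝ → ℝ be infinitely differentiable on Ω and satisfy the heat equation ∂_t u − Δ_x u = 0 on Ω. Then the extended (anisotropic) Taylor polynomial P(x, t) := Σ_{(j_x, j_t) ∈ ℕ^d × ℕ : 2 j_t + |j_x| ≤ 2p} (1/(j_x! j_t!)) D^{(j_x, j_t)} u(z, s) (x − z)^{j_x} (t − s)^{j_t} is a polynomial of total degree at most 2p satisfying the heat equation ∂_t P − Δ_x P = 0 identically on ℝ^d × ℝ. -/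

import Mathlib

noncomputable section

/-- Spatial partial derivative `∂/∂x_ℓ` of a real-valued function on `ℝ^d × ℝ`. -/
def pS (d : ℕ) (ℓ : Fin d) (f : (Fin d → ℝ) × ℝ → ℝ) : (Fin d → ℝ) × ℝ → ℝ :=
  fun y => fderiv ℝ f y (Pi.single ℓ 1, 0)

/-- Time partial derivative `∂/∂t` of a real-valued function on `ℝ^d × ℝ`. -/
def pT (d : ℕ) (f : (Fin d → ℝ) × ℝ → ℝ) : (Fin d → ℝ) × ℝ → ℝ :=
  fun y => fderiv ℝ f y (0, 1)

/-- Multi-index partial derivative `D^{(j_x, j_t)}`. -/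
def Dm (d : ℕ) (jx : Fin d → ℕ) (jt : ℕ) (f : (Fin d → ℝ) × ℝ → ℝ) : (Fin d → ℝ) × ℝ → ℝ :=
  (pT d)^[jt] ((List.finRange d).foldr (fun ℓ g => (pS d ℓ)^[jx ℓ] ∘ g) id f)

/-- The extended (anisotropic) Taylor polynomial of degree `2p` of `u` centered at `(z, s)`:
`P(x,t) = Σ_{2 j_t + |j_x| ≤ 2p} (1/(j_x! j_t!)) D^{(j_x,j_t)} u(z,s) (x−z)^{j_x} (t−s)^{j_t}`. -/
def extTaylorHeat (d p : ℕ) (u : (Fin d → ℝ) × ℝ → ℝ) (z : Fin d → ℝ) (s : ℝ) :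
    (Fin d → ℝ) × ℝ → ℝ := fun y =>
  ∑ jt ∈ Finset.range (p + 1),
    ∑ jx ∈ Fintype.piFinset (fun _ : Fin d => Finset.range (2 * p + 1)),
      if 2 * jt + ∑ ℓ, jx ℓ ≤ 2 * p then
        (((∏ ℓ, (jx ℓ).factorial) * jt.factorial : ℕ) : ℝ)⁻¹ * Dm d jx jt u (z, s) *
          (∏ ℓ, (y.1 ℓ - z ℓ) ^ jx ℓ) * (y.2 - s) ^ jt
      else 0

open scoped ContDiff

section ConstantCoefficientOperators

variable {E : Type*} [NormedAddCommGroup E] [NormedSpace ℝ E] {Ω : Set E}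

/-- The derivative of `f` in the constant direction `v`. -/
def dirDeriv (v : E) (f : E → ℝ) : E → ℝ := fun y => fderiv ℝ f y v

theorem ContDiffOn.dirDeriv (hΩ : IsOpen Ω) {f : E → ℝ} (hf : ContDiffOn ℝ ∞ f Ω) (v : E) :
    ContDiffOn ℝ ∞ (dirDeriv v f) Ω :=
  (hf.fderiv_of_isOpen hΩ (m := ∞) (by simp)).clm_apply contDiffOn_const

theorem Set.EqOn.dirDeriv (hΩ : IsOpen Ω) {f g : E → ℝ} (h : Set.EqOn f g Ω) (v : E) :
    Set.EqOn (dirDeriv v f) (dirDeriv v g) Ω := fun y hy => by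
  have : f =ᶠ[nhds y] g := Filter.eventuallyEq_of_mem (hΩ.mem_nhds hy) h
  simp only [_root_.dirDeriv, this.fderiv_eq]

theorem ContDiffOn.dirDeriv_comm (hΩ : IsOpen Ω) {f : E → ℝ} (hf : ContDiffOn ℝ ∞ f Ω)
    (v w : E) : Set.EqOn (_root_.dirDeriv v (_root_.dirDeriv w f))
      (_root_.dirDeriv w (_root_.dirDeriv v f)) Ω := fun y hy => by
  have hd : DifferentiableAt ℝ (fderiv ℝ f) y :=
    ((hf.fderiv_of_isOpen hΩ (m := ∞) (by simp)).contDiffAt (hΩ.mem_nhds hy)).differentiableAt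
      (by simp)
  have hs : IsSymmSndFDerivAt ℝ f y :=
    (hf.contDiffAt (hΩ.mem_nhds hy)).isSymmSndFDerivAt (by
      rw [minSmoothness_of_isRCLikeNormedField]
      exact WithTop.coe_le_coe.2 (le_top : (2 : ℕ∞) ≤ ⊤))
  have key (a b : E) : fderiv ℝ (fun y => fderiv ℝ f y b) y a = fderiv ℝ (fderiv ℝ f) y a b := by
    rw [fderiv_clm_apply hd (differentiableAt_const b)]
    simp
  exact (key v w).trans ((hs v w).trans (key w v).symm)

/-- The properties, on functions smooth on `Ω` and considered up to equality on `Ω`, shared by the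
differential operators with constant coefficients. -/
structure IsConstCoeffOp (Ω : Set E) (T : (E → ℝ) → E → ℝ) : Prop where
  contDiffOn : ∀ {f}, ContDiffOn ℝ ∞ f Ω → ContDiffOn ℝ ∞ (T f) Ω
  eqOn : ∀ {f g}, Set.EqOn f g Ω → Set.EqOn (T f) (T g) Ω
  comm : ∀ {f}, ContDiffOn ℝ ∞ f Ω → ∀ v,
    Set.EqOn (T (dirDeriv v f)) (dirDeriv v (T f)) Ω
  sum : ∀ {n : ℕ} (F : Fin n → E → ℝ), (∀ i, ContDiffOn ℝ ∞ (F i) Ω) →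
    Set.EqOn (T fun y => ∑ i, F i y) (fun y => ∑ i, T (F i) y) Ω

theorem IsConstCoeffOp.id : IsConstCoeffOp Ω id :=
  ⟨fun h => h, fun h => h, fun _ _ _ _ => rfl, fun _ _ _ _ => rfl⟩

theorem IsConstCoeffOp.comp {S T : (E → ℝ) → E → ℝ} (hS : IsConstCoeffOp Ω S)
    (hT : IsConstCoeffOp Ω T) : IsConstCoeffOp Ω (S ∘ T) where
  contDiffOn h := hS.contDiffOn (hT.contDiffOn h)
  eqOn h := hS.eqOn (hT.eqOn h)
  comm h v := (hS.eqOn (hT.comm h v)).trans (hS.comm (hT.contDiffOn h) v)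
  sum F hF := (hS.eqOn (hT.sum F hF)).trans (hS.sum _ fun i => hT.contDiffOn (hF i))

theorem IsConstCoeffOp.dirDeriv (hΩ : IsOpen Ω) (v : E) : IsConstCoeffOp Ω (dirDeriv v) where
  contDiffOn h := h.dirDeriv hΩ v
  eqOn h := h.dirDeriv hΩ v
  comm h w := h.dirDeriv_comm hΩ v w
  sum F hF y hy := by
    simp only [_root_.dirDeriv]
    rw [fderiv_fun_sum fun i _ =>
      ((hF i).contDiffAt (hΩ.mem_nhds hy)).differentiableAt (by simp)]
    simp

theorem IsConstCoeffOp.iterate {T : (E → ℝ) → E → ℝ} (hT : IsConstCoeffOp Ω T)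
    (n : ℕ) : IsConstCoeffOp Ω T^[n] := by
  induction n with
  | zero => exact .id
  | succ n ih => exact ih.comp hT

end ConstantCoefficientOperators

section MixedDerivatives

variable {d : ℕ} {Ω : Set ((Fin d → ℝ) × ℝ)}

/-- The iterated spatial derivative of orders `jx` in the coordinates listed in `l`. -/
def spaceDeriv (jx : Fin d → ℕ) (l : List (Fin d)) :
    ((Fin d → ℝ) × ℝ → ℝ) → (Fin d → ℝ) × ℝ → ℝ :=
  l.foldr (fun ℓ g => (pS d ℓ)^[jx ℓ] ∘ g) id

theorem isConstCoeffOp_pS (hΩ : IsOpen Ω) (ℓ : Fin d) : IsConstCoeffOp Ω (pS d ℓ) :=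
  .dirDeriv hΩ _

theorem isConstCoeffOp_pT (hΩ : IsOpen Ω) : IsConstCoeffOp Ω (pT d) :=
  .dirDeriv hΩ _

theorem isConstCoeffOp_spaceDeriv (hΩ : IsOpen Ω) (jx : Fin d → ℕ) (l : List (Fin d)) :
    IsConstCoeffOp Ω (spaceDeriv jx l) := by
  induction l with
  | nil => exact .id
  | cons a l ih => exact ((isConstCoeffOp_pS hΩ a).iterate _).comp ih

theorem isConstCoeffOp_Dm (hΩ : IsOpen Ω) (jx : Fin d → ℕ) (jt : ℕ) :
    IsConstCoeffOp Ω (Dm d jx jt) :=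
  ((isConstCoeffOp_pT hΩ).iterate jt).comp (isConstCoeffOp_spaceDeriv hΩ jx _)

theorem spaceDeriv_add_single_of_notMem (jx : Fin d → ℕ) {ℓ : Fin d} {l : List (Fin d)}
    (h : ℓ ∉ l) : spaceDeriv (jx + Pi.single ℓ 1) l = spaceDeriv jx l := by
  induction l with
  | nil => rfl
  | cons a l ih =>
    simp only [List.mem_cons, not_or] at h
    have ih := ih h.2
    simp only [spaceDeriv, List.foldr_cons] at ih ⊢
    rw [ih]
    simp [Pi.single_eq_of_ne (Ne.symm h.1)]

theorem spaceDeriv_add_single (hΩ : IsOpen Ω) {f : (Fin d → ℝ) × ℝ → ℝ}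
    (hf : ContDiffOn ℝ ∞ f Ω) (jx : Fin d → ℕ) {ℓ : Fin d} {l : List (Fin d)} (h : ℓ ∈ l)
    (hl : l.Nodup) :
    Set.EqOn (spaceDeriv (jx + Pi.single ℓ 1) l f) (spaceDeriv jx l (pS d ℓ f)) Ω := by
  induction l with
  | nil => simp at h
  | cons a l ih =>
    have hcons (j : Fin d → ℕ) (g : (Fin d → ℝ) × ℝ → ℝ) :
        spaceDeriv j (a :: l) g = (pS d a)^[j a] (spaceDeriv j l g) := rfl
    rw [List.nodup_cons] at hl
    rw [hcons, hcons]
    by_cases ha : ℓ = a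
    · subst ha
      rw [spaceDeriv_add_single_of_notMem jx hl.1]
      simp only [Pi.add_apply, Pi.single_eq_same, Function.iterate_succ_apply]
      exact ((isConstCoeffOp_pS hΩ ℓ).iterate _).eqOn
        ((isConstCoeffOp_spaceDeriv hΩ jx l).comm hf _).symm
    · simp only [Pi.add_apply, Pi.single_eq_of_ne (Ne.symm ha), add_zero]
      exact ((isConstCoeffOp_pS hΩ a).iterate _).eqOn
        (ih ((List.mem_cons.1 h).resolve_left ha) hl.2)

theorem Dm_add_single (hΩ : IsOpen Ω) {f : (Fin d → ℝ) × ℝ → ℝ} (hf : ContDiffOn ℝ ∞ f Ω)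
    (jx : Fin d → ℕ) (jt : ℕ) (ℓ : Fin d) :
    Set.EqOn (Dm d (jx + Pi.single ℓ 1) jt f) (Dm d jx jt (pS d ℓ f)) Ω :=
  ((isConstCoeffOp_pT hΩ).iterate jt).eqOn
    (spaceDeriv_add_single hΩ hf jx (List.mem_finRange ℓ) (List.nodup_finRange d))

theorem Dm_succ (hΩ : IsOpen Ω) {f : (Fin d → ℝ) × ℝ → ℝ} (hf : ContDiffOn ℝ ∞ f Ω)
    (jx : Fin d → ℕ) (jt : ℕ) : Set.EqOn (Dm d jx (jt + 1) f) (Dm d jx jt (pT d f)) Ω :=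
  ((isConstCoeffOp_pT hΩ).iterate jt).eqOn
    ((isConstCoeffOp_spaceDeriv hΩ jx _).comm hf _).symm

theorem Dm_succ_of_heat (hΩ : IsOpen Ω) {u : (Fin d → ℝ) × ℝ → ℝ} (hu : ContDiffOn ℝ ∞ u Ω)
    (hheat : ∀ y ∈ Ω, pT d u y - ∑ ℓ, pS d ℓ (pS d ℓ u) y = 0) (jx : Fin d → ℕ) (jt : ℕ) :
    Set.EqOn (Dm d jx (jt + 1) u)
      (fun y => ∑ ℓ, Dm d (jx + Pi.single ℓ 1 + Pi.single ℓ 1) jt u y) Ω := by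
  have hS (ℓ : Fin d) : ContDiffOn ℝ ∞ (pS d ℓ u) Ω := (isConstCoeffOp_pS hΩ ℓ).contDiffOn hu
  intro y hy
  have hD := isConstCoeffOp_Dm hΩ jx jt
  rw [Dm_succ hΩ hu jx jt hy, hD.eqOn (fun y hy => sub_eq_zero.1 (hheat y hy)) hy,
    hD.sum _ (fun ℓ => (isConstCoeffOp_pS hΩ ℓ).contDiffOn (hS ℓ)) hy]
  refine Finset.sum_congr rfl fun ℓ _ => ?_
  rw [Dm_add_single hΩ hu _ jt ℓ hy, Dm_add_single hΩ (hS ℓ) jx jt ℓ hy]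

end MixedDerivatives

namespace MvPolynomial

theorem totalDegree_bind₁_le {σ τ R : Type*} [CommSemiring R] {f : σ → MvPolynomial τ R}
    (hf : ∀ v, (f v).totalDegree ≤ 1) (Q : MvPolynomial σ R) :
    (bind₁ f Q).totalDegree ≤ Q.totalDegree := by
  rw [bind₁, aeval_def, eval₂_eq]
  refine (totalDegree_finsetSum _ _).trans (Finset.sup_le fun m hm => ?_)
  refine (totalDegree_mul _ _).trans ?_
  rw [algebraMap_eq, totalDegree_C, zero_add]
  refine (totalDegree_finsetProd _ _).trans (le_trans ?_ (le_totalDegree hm))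
  refine Finset.sum_le_sum fun v _ => (totalDegree_pow _ _).trans ?_
  exact (Nat.mul_le_mul_left _ (hf v)).trans (mul_one _).le

theorem hasFDerivAt_eval {E σ : Type*} [NormedAddCommGroup E] [NormedSpace ℝ E] [Fintype σ]
    {g : E → σ → ℝ} {g' : σ → E →L[ℝ] ℝ} {y : E}
    (hg : ∀ v, HasFDerivAt (fun x => g x v) (g' v) y) (Q : MvPolynomial σ ℝ) :
    HasFDerivAt (fun x => eval (g x) Q) (∑ v, eval (g y) (pderiv v Q) • g' v) y := by
  classical
  induction Q using MvPolynomial.induction_on with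
  | C a => simpa using hasFDerivAt_const a y
  | add P Q hP hQ =>
    simp only [map_add, add_smul, Finset.sum_add_distrib]
    exact hP.add hQ
  | mul_X P v hP =>
    have h := hP.mul (hg v)
    simp only [map_mul, eval_X]
    refine h.congr_fderiv ?_
    simp only [Derivation.leibniz, pderiv_X, smul_eq_mul, map_add, map_mul, eval_X, add_smul,
      Finset.sum_add_distrib, Finset.smul_sum, mul_smul]
    congr 1
    rw [Finset.sum_eq_single v]
    · simp
    · intro w _ hw
      simp [Pi.single_eq_of_ne (Ne.symm hw)]
    · simp

end MvPolynomial

section HeatPolynomial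

open MvPolynomial

variable {d : ℕ}

/-- The exponent vector in the variables `(t, x)` with time exponent `jt` and space exponents
`jx`. -/
def heatExponent (jx : Fin d → ℕ) (jt : ℕ) : Option (Fin d) →₀ ℕ :=
  Finsupp.equivFunOnFinite.symm fun v => v.elim jt jx

@[simp]
theorem heatExponent_none (jx : Fin d → ℕ) (jt : ℕ) : heatExponent jx jt none = jt := rfl

@[simp]
theorem heatExponent_some (jx : Fin d → ℕ) (jt : ℕ) (ℓ : Fin d) :
    heatExponent jx jt (some ℓ) = jx ℓ := rfl

theorem exists_eq_heatExponent (m : Option (Fin d) →₀ ℕ) : ∃ jx jt, m = heatExponent jx jt :=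
  ⟨fun ℓ => m (some ℓ), m none, by ext (_ | _) <;> rfl⟩

theorem heatExponent_inj {jx kx : Fin d → ℕ} {jt kt : ℕ} :
    heatExponent jx jt = heatExponent kx kt ↔ jx = kx ∧ jt = kt := by
  refine ⟨fun h => ⟨funext fun ℓ => ?_, ?_⟩, fun h => by rw [h.1, h.2]⟩
  · simpa using DFunLike.congr_fun h (some ℓ)
  · simpa using DFunLike.congr_fun h none

theorem heatExponent_add_single_none (jx : Fin d → ℕ) (jt : ℕ) :
    heatExponent jx jt + Finsupp.single none 1 = heatExponent jx (jt + 1) := by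
  ext (_ | _) <;> simp

theorem heatExponent_add_single_some (jx : Fin d → ℕ) (jt : ℕ) (ℓ : Fin d) :
    heatExponent jx jt + Finsupp.single (some ℓ) 1 = heatExponent (jx + Pi.single ℓ 1) jt := by
  ext (_ | k)
  · simp
  · by_cases h : ℓ = k
    · subst h; simp
    · simp [h]

/-- The polynomial with Taylor coefficients `c` truncated at parabolic degree `2p`. -/
def heatPoly (p : ℕ) (c : (Fin d → ℕ) → ℕ → ℝ) : MvPolynomial (Option (Fin d)) ℝ :=
  ∑ jt ∈ Finset.range (p + 1),
    ∑ jx ∈ Fintype.piFinset (fun _ : Fin d => Finset.range (2 * p + 1)),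
      if 2 * jt + ∑ ℓ, jx ℓ ≤ 2 * p then
        monomial (heatExponent jx jt)
          ((((∏ ℓ, (jx ℓ).factorial) * jt.factorial : ℕ) : ℝ)⁻¹ * c jx jt)
      else 0

theorem coeff_heatPoly (p : ℕ) (c : (Fin d → ℕ) → ℕ → ℝ) (jx : Fin d → ℕ) (jt : ℕ) :
    coeff (heatExponent jx jt) (heatPoly p c) =
      if 2 * jt + ∑ ℓ, jx ℓ ≤ 2 * p then
        (((∏ ℓ, (jx ℓ).factorial) * jt.factorial : ℕ) : ℝ)⁻¹ * c jx jt
      else 0 := by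
  classical
  simp only [heatPoly, coeff_sum, apply_ite (coeff (heatExponent jx jt)), coeff_monomial,
    coeff_zero, heatExponent_inj]
  rw [Finset.sum_eq_single jt, Finset.sum_eq_single jx]
  · simp
  · intro kx _ hk
    simp [hk]
  · intro h
    rw [if_neg]
    contrapose! h
    simp only [Fintype.mem_piFinset, Finset.mem_range]
    intro ℓ
    have := Finset.single_le_sum (f := jx) (fun _ _ => Nat.zero_le _) (Finset.mem_univ ℓ)
    omega
  · intro kt _ hk
    simp [hk]
  · intro h
    refine Finset.sum_eq_zero fun kx _ => ?_
    simp only [Finset.mem_range] at h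
    rw [if_neg (by omega)]

theorem totalDegree_heatPoly_le (p : ℕ) (c : (Fin d → ℕ) → ℕ → ℝ) :
    (heatPoly p c).totalDegree ≤ 2 * p := by
  refine totalDegree_finsetSum_le fun jt _ => totalDegree_finsetSum_le fun jx _ => ?_
  split_ifs with h
  · refine (totalDegree_monomial_le _ _).trans ?_
    rw [Finsupp.sum_fintype _ _ (by simp), Fintype.sum_option]
    simp only [heatExponent_none, heatExponent_some, id]
    omega
  · simp

theorem prod_factorial_add_single (jx : Fin d → ℕ) (ℓ : Fin d) :
    ∏ k, ((jx + Pi.single ℓ 1 : Fin d → ℕ) k).factorial = (jx ℓ + 1) * ∏ k, (jx k).factorial := by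
  rw [← Finset.mul_prod_erase _ _ (Finset.mem_univ ℓ),
    ← Finset.mul_prod_erase Finset.univ (fun k => (jx k).factorial) (Finset.mem_univ ℓ),
    ← mul_assoc]
  congr 1
  · simp [Nat.factorial_succ]
  · refine Finset.prod_congr rfl fun k hk => ?_
    simp [Pi.single_eq_of_ne (Finset.ne_of_mem_erase hk)]

theorem pderiv_heatPoly (p : ℕ) {c : (Fin d → ℕ) → ℕ → ℝ}
    (hc : ∀ jx jt, c jx (jt + 1) = ∑ ℓ, c (jx + Pi.single ℓ 1 + Pi.single ℓ 1) jt) :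
    pderiv none (heatPoly p c) = ∑ ℓ, pderiv (some ℓ) (pderiv (some ℓ) (heatPoly p c)) := by
  ext m
  obtain ⟨jx, jt, rfl⟩ := exists_eq_heatExponent m
  simp only [coeff_sum, coeff_pderiv, heatExponent_add_single_none, heatExponent_add_single_some,
    coeff_heatPoly, heatExponent_none, heatExponent_some, prod_factorial_add_single, hc]
  have hsum (ℓ : Fin d) : ∑ k, (jx + Pi.single ℓ 1 + Pi.single ℓ 1 : Fin d → ℕ) k = (∑ k, jx k) + 2 := by
    simp [Finset.sum_add_distrib, add_assoc]
  by_cases h : 2 * (jt + 1) + ∑ k, jx k ≤ 2 * p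
  · rw [if_pos h, Finset.mul_sum, Finset.sum_mul]
    refine Finset.sum_congr rfl fun ℓ _ => ?_
    rw [hsum, if_pos (by omega), Nat.factorial_succ]
    have hP : ((∏ k, (jx k).factorial : ℕ) : ℝ) ≠ 0 := by
      exact_mod_cast Finset.prod_ne_zero_iff.2 fun k _ => (jx k).factorial_ne_zero
    have hT : (jt.factorial : ℝ) ≠ 0 := by exact_mod_cast jt.factorial_ne_zero
    have h1 : (jt : ℝ) + 1 ≠ 0 := by positivity
    have h2 : (jx ℓ : ℝ) + 1 ≠ 0 := by positivity
    have h3 : (jx ℓ : ℝ) + 1 + 1 ≠ 0 := by positivity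
    simp only [Pi.add_apply, Pi.single_eq_same]
    generalize (∏ k, (jx k).factorial : ℕ) = P at hP ⊢
    push_cast
    field_simp
  · rw [if_neg h, zero_mul]
    refine (Finset.sum_eq_zero fun ℓ _ => ?_).symm
    rw [hsum, if_neg (by omega), zero_mul, zero_mul]

/-- The coordinates of a point of `ℝ^d × ℝ` relative to the centre `(z, s)`. -/
def centredCoord (z : Fin d → ℝ) (s : ℝ) (y : (Fin d → ℝ) × ℝ) : Option (Fin d) → ℝ :=
  fun v => v.elim (y.2 - s) fun ℓ => y.1 ℓ - z ℓ

theorem eval_heatPoly (p : ℕ) (u : (Fin d → ℝ) × ℝ → ℝ) (z : Fin d → ℝ) (s : ℝ)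
    (y : (Fin d → ℝ) × ℝ) :
    eval (centredCoord z s y) (heatPoly p fun jx jt => Dm d jx jt u (z, s)) =
      extTaylorHeat d p u z s y := by
  simp only [heatPoly, extTaylorHeat, map_sum, apply_ite (eval (centredCoord z s y)),
    eval_monomial, map_zero]
  refine Finset.sum_congr rfl fun jt _ => Finset.sum_congr rfl fun jx _ => ?_
  rw [Finsupp.prod_fintype _ _ (by simp), Fintype.prod_option]
  simp only [heatExponent_none, heatExponent_some, centredCoord, Option.elim]
  split_ifs <;> ring

theorem hasFDerivAt_eval_centredCoord (z : Fin d → ℝ) (s : ℝ)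
    (Q : MvPolynomial (Option (Fin d)) ℝ) (y : (Fin d → ℝ) × ℝ) :
    HasFDerivAt (fun x => eval (centredCoord z s x) Q)
      (∑ v : Option (Fin d), eval (centredCoord z s y) (pderiv v Q) •
        v.elim (ContinuousLinearMap.snd ℝ (Fin d → ℝ) ℝ) fun ℓ =>
          (ContinuousLinearMap.proj ℓ).comp (ContinuousLinearMap.fst ℝ (Fin d → ℝ) ℝ)) y := by
  refine hasFDerivAt_eval (fun v => ?_) Q
  cases v with
  | none => exact hasFDerivAt_snd.sub_const s
  | some ℓ =>
    exact ((ContinuousLinearMap.proj (R := ℝ) (φ := fun _ : Fin d => ℝ) ℓ).comp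
      (ContinuousLinearMap.fst ℝ (Fin d → ℝ) ℝ)).hasFDerivAt.sub_const (z ℓ)

theorem pT_eval_centredCoord (z : Fin d → ℝ) (s : ℝ) (Q : MvPolynomial (Option (Fin d)) ℝ) :
    pT d (fun y => eval (centredCoord z s y) Q) =
      fun y => eval (centredCoord z s y) (pderiv none Q) := by
  funext y
  rw [pT, (hasFDerivAt_eval_centredCoord z s Q y).fderiv]
  simp

theorem pS_eval_centredCoord (z : Fin d → ℝ) (s : ℝ) (Q : MvPolynomial (Option (Fin d)) ℝ)
    (ℓ : Fin d) :
    pS d ℓ (fun y => eval (centredCoord z s y) Q) =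
      fun y => eval (centredCoord z s y) (pderiv (some ℓ) Q) := by
  funext y
  rw [pS, (hasFDerivAt_eval_centredCoord z s Q y).fderiv]
  simp [Pi.single_apply]

end HeatPolynomial

/-- If `u` is smooth on an open set `Ω ∋ (z,s)` and satisfies the heat equation
`∂_t u − Δ_x u = 0` on `Ω`, then its extended Taylor polynomial of degree `2p` centered at
`(z,s)` is a polynomial in `(x,t)` of total degree at most `2p` and satisfies the heat
equation on all of `ℝ^d × ℝ`. -/
theorem extTaylor_heat_polynomial (d p : ℕ) (hd : 1 ≤ d)
    (Ω : Set ((Fin d → ℝ) × ℝ)) (hΩ : IsOpen Ω) (z : Fin d → ℝ) (s : ℝ) (hzs : (z, s) ∈ Ω)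
    (u : (Fin d → ℝ) × ℝ → ℝ) (hsmooth : ContDiffOn ℝ (⊤ : ℕ∞) u Ω)
    (hheat : ∀ y ∈ Ω, pT d u y - ∑ ℓ, pS d ℓ (pS d ℓ u) y = 0) :
    (∃ Q : MvPolynomial (Option (Fin d)) ℝ, Q.totalDegree ≤ 2 * p ∧
      ∀ y : (Fin d → ℝ) × ℝ,
        MvPolynomial.eval (fun v => v.elim y.2 (fun ℓ => y.1 ℓ)) Q
          = extTaylorHeat d p u z s y) ∧
    ∀ y : (Fin d → ℝ) × ℝ,
      pT d (extTaylorHeat d p u z s) y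
        - ∑ ℓ, pS d ℓ (pS d ℓ (extTaylorHeat d p u z s)) y = 0 := by
  set Q := heatPoly p fun jx jt => Dm d jx jt u (z, s)
  have hP : extTaylorHeat d p u z s = fun y => MvPolynomial.eval (centredCoord z s y) Q :=
    funext fun y => (eval_heatPoly p u z s y).symm
  refine ⟨⟨MvPolynomial.bind₁ (fun v => MvPolynomial.X v - MvPolynomial.C (v.elim s z)) Q,
    (MvPolynomial.totalDegree_bind₁_le (fun v => ?_) Q).trans (totalDegree_heatPoly_le p _),
    fun y => ?_⟩, fun y => ?_⟩
  · exact (MvPolynomial.totalDegree_sub_C_le _ _).trans (MvPolynomial.totalDegree_X v).le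
  · rw [hP, MvPolynomial.eval, MvPolynomial.eval₂Hom_bind₁]
    congr 2
    funext v
    cases v <;> simp [centredCoord]
  · have h := pderiv_heatPoly p (c := fun jx jt => Dm d jx jt u (z, s)) fun jx jt =>
      Dm_succ_of_heat hΩ hsmooth hheat jx jt hzs
    simp only [hP, pT_eval_centredCoord, pS_eval_centredCoord]
    rw [h, map_sum, sub_self]
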